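/- Let q/(q+1) < p < ∞, 1 < q < ∞, and r = pq/(pq+p−q). Then for all x ∈ [0, π_{p,q}/2), cos_{p,q}(x) = 1 / (cosh_{r,q}(x))^{r/p}. -/

import Mathlib

open MeasureTheory Set
open scoped ENNReal

/-- `genF p q y = ∫_0^y (1 - t^q)^(-1/p) dt`, whose inverse is the generalized sine. -/
noncomputable def genF (p q y : ℝ) : ℝ := ∫ t in (0:ℝ)..y, (1 - t ^ q) ^ (-(1 / p))

/-- `genG p q y = ∫_0^y (1 + t^q)^(-1/p) dt`, whose inverse is the generalized hyperbolic sine. -/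
noncomputable def genG (p q y : ℝ) : ℝ := ∫ t in (0:ℝ)..y, (1 + t ^ q) ^ (-(1 / p))

/-- The generalized π, `π_{p,q} = 2∫_0^1 (1 - t^q)^(-1/p) dt`, as an extended real number
(it is `∞` when `q/(q+1) < p ≤ 1`). -/
noncomputable def genPi (p q : ℝ) : ℝ≥0∞ :=
  2 * ∫⁻ t in Ioo (0:ℝ) 1, ENNReal.ofReal ((1 - t ^ q) ^ (-(1 / p)))

/-- The generalized sine `sin_{p,q}`: the inverse of `genF p q`, which maps `[0,1)` onto
`[0, π_{p,q}/2)`. -/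
noncomputable def gsin (p q : ℝ) : ℝ → ℝ := Function.invFunOn (genF p q) (Ico 0 1)

/-- The generalized cosine `cos_{p,q} x = (d/dx) sin_{p,q} x` (one-sided at `x = 0`). -/
noncomputable def gcos (p q x : ℝ) : ℝ := derivWithin (gsin p q) (Ici 0) x

/-- The generalized hyperbolic sine `sinh_{p,q}`: the inverse of `genG p q`, which maps
`[0,∞)` onto `[0, π_{r,q}/2)` where `r = pq/(pq+p-q)`. -/
noncomputable def gsinh (p q : ℝ) : ℝ → ℝ := Function.invFunOn (genG p q) (Ici 0)

/-- The generalized hyperbolic cosine `cosh_{p,q} x = (d/dx) sinh_{p,q} x`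
(one-sided at `x = 0`). -/
noncomputable def gcosh (p q x : ℝ) : ℝ := derivWithin (gsinh p q) (Ici 0) x

open Filter Topology

/-- Fundamental theorem of calculus, one-sided at `0`, for an integrand continuous on an
interval `[0, b]`. -/
theorem hasDerivWithinAt_integral_Ici {φ : ℝ → ℝ} {b y : ℝ} (hφ : ContinuousOn φ (Icc 0 b))
    (hy0 : 0 ≤ y) (hyb : y < b) :
    HasDerivWithinAt (fun u => ∫ t in (0:ℝ)..u, φ t) (φ y) (Ici 0) y := by
  have hb : (0:ℝ) ≤ b := hy0.trans hyb.le
  set ψ : ℝ → ℝ := IccExtend hb ((Icc 0 b).domRestrict φ)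
  have hψ : Continuous ψ := (continuousOn_iff_continuous_domRestrict.1 hφ).Icc_extend'
  have heq : ∀ t ∈ Icc 0 b, ψ t = φ t := fun t ht => IccExtend_of_mem hb _ ht
  have hint : ∀ u ∈ Icc 0 b, ∫ t in (0:ℝ)..u, φ t = ∫ t in (0:ℝ)..u, ψ t := by
    intro u hu
    refine intervalIntegral.integral_congr fun t ht => ?_
    rw [uIcc_of_le hu.1] at ht
    exact (heq t ⟨ht.1, ht.2.trans hu.2⟩).symm
  have hd : HasDerivWithinAt (fun u => ∫ t in (0:ℝ)..u, ψ t) (φ y) (Ici 0) y := by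
    rw [← heq y ⟨hy0, hyb.le⟩]
    exact (hψ.integral_hasStrictDerivAt 0 y).hasDerivAt.hasDerivWithinAt
  refine hd.congr_of_eventuallyEq ?_ (hint y ⟨hy0, hyb.le⟩)
  filter_upwards [self_mem_nhdsWithin, mem_nhdsWithin_of_mem_nhds (Iio_mem_nhds hyb)] with u h1 h2
  exact hint u ⟨h1, le_of_lt h2⟩

theorem strictMonoOn_integral {φ : ℝ → ℝ} {s : Set ℝ} (hs : ∀ y ∈ s, 0 ≤ y ∧ Icc 0 y ⊆ s)
    (hφ : ContinuousOn φ s) (hpos : ∀ t ∈ s, 0 < φ t) :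
    StrictMonoOn (fun u => ∫ t in (0:ℝ)..u, φ t) s := by
  intro a ha c hc hac
  have hsub : Icc a c ⊆ s := fun t ht => (hs c hc).2 ⟨(hs a ha).1.trans ht.1, ht.2⟩
  have hi : ∀ u ∈ s, IntervalIntegrable φ volume 0 u := fun u hu =>
    (hφ.mono (by rw [uIcc_of_le (hs u hu).1]; exact (hs u hu).2)).intervalIntegrable
  have h := intervalIntegral.intervalIntegral_pos_of_pos_on
    ((hi a ha).symm.trans (hi c hc)) (fun t ht => hpos t (hsub (Ioo_subset_Icc_self ht))) hac
  have h2 := intervalIntegral.integral_interval_sub_left (hi c hc) (hi a ha)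
  simp only
  linarith

/-- The derivative of the inverse of `u ↦ ∫_0^u φ` on an interval `s` starting at `0`. -/
theorem derivWithin_invFunOn_integral {φ : ℝ → ℝ} {s : Set ℝ}
    (hs : ∀ y ∈ s, 0 ≤ y ∧ Icc 0 y ⊆ s) (hs' : ∀ y ∈ s, ∃ b ∈ s, y < b)
    (hφ : ContinuousOn φ s) (hpos : ∀ t ∈ s, 0 < φ t) {y : ℝ} (hy : y ∈ s) :
    derivWithin (Function.invFunOn (fun u => ∫ t in (0:ℝ)..u, φ t) s) (Ici 0)
      (∫ t in (0:ℝ)..y, φ t) = (φ y)⁻¹ := by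
  have hmono := strictMonoOn_integral hs hφ hpos
  have hder : ∀ y ∈ s, HasDerivWithinAt (fun u => ∫ t in (0:ℝ)..u, φ t) (φ y) (Ici 0) y := by
    intro y hy
    obtain ⟨b, hb, hyb⟩ := hs' y hy
    exact hasDerivWithinAt_integral_Ici (hφ.mono (hs b hb).2) (hs y hy).1 hyb
  set f : ℝ → ℝ := fun u => ∫ t in (0:ℝ)..u, φ t with hf
  set g := Function.invFunOn f s
  change derivWithin g (Ici 0) (f y) = _
  have hf0 : f 0 = 0 := by simp [hf]
  have h0s : ∀ y ∈ s, (0:ℝ) ∈ s := fun y hy => (hs y hy).2 ⟨le_rfl, (hs y hy).1⟩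
  have hfy : 0 ≤ f y := hf0 ▸ hmono.monotoneOn (h0s y hy) hy (hs y hy).1
  have hgf : ∀ u ∈ s, g (f u) = u := fun u hu => hmono.injOn.leftInvOn_invFunOn hu
  have hcont : ∀ b ∈ s, ContinuousOn f (Icc 0 b) := fun b hb u hu =>
    ((hder u ((hs b hb).2 hu)).continuousWithinAt).mono Icc_subset_Ici_self
  have hsurj : ∀ᶠ w in 𝓝[Ici 0] (f y), g w ∈ s ∧ f (g w) = w := by
    obtain ⟨b, hb, hyb⟩ := hs' y hy
    filter_upwards [self_mem_nhdsWithin,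
      mem_nhdsWithin_of_mem_nhds (Iio_mem_nhds (hmono hy hb hyb))] with w h1 h2
    have hw : w ∈ f '' Icc 0 b :=
      intermediate_value_Icc (hs b hb).1 (hcont b hb) ⟨hf0.trans_le h1, le_of_lt h2⟩
    obtain ⟨u, hu, rfl⟩ := hw
    have hus := (hs b hb).2 hu
    rw [hgf u hus]
    exact ⟨hus, rfl⟩
  have hgc : Tendsto g (𝓝[Ici 0] (f y)) (𝓝[Ici 0] y) := by
    refine tendsto_nhdsWithin_iff.2 ⟨tendsto_order.2 ⟨fun a ha => ?_, fun a ha => ?_⟩,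
      hsurj.mono fun w hw => (hs _ hw.1).1⟩
    · rcases lt_or_ge a 0 with h | h
      · exact hsurj.mono fun w hw => h.trans_le (hs _ hw.1).1
      · have has : a ∈ s := (hs y hy).2 ⟨h, ha.le⟩
        filter_upwards [hsurj, mem_nhdsWithin_of_mem_nhds (Ioi_mem_nhds (hmono has hy ha))]
          with w hw h2
        rw [← hmono.lt_iff_lt has hw.1, hw.2]
        exact h2
    · obtain ⟨b, hb, hyb⟩ := hs' y hy
      have hcs : min a b ∈ s := (hs b hb).2 ⟨(hs y hy).1.trans (lt_min ha hyb).le, min_le_right _ _⟩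
      filter_upwards [hsurj,
        mem_nhdsWithin_of_mem_nhds (Iio_mem_nhds (hmono hy hcs (lt_min ha hyb)))] with w hw h2
      refine lt_of_lt_of_le ?_ (min_le_left a b)
      rw [← hmono.lt_iff_lt hw.1 hcs, hw.2]
      exact h2
  have key : HasDerivWithinAt g (φ y)⁻¹ (Ici 0) (f y) := by
    have hdy := hder y hy
    have hgc' : Tendsto g (𝓝[Ici 0] (f y)) (𝓝[Ici 0] (g (f y))) := by rwa [hgf y hy]
    have hdy' : HasFDerivWithinAt f
        (ContinuousLinearEquiv.unitsEquivAut ℝ (Units.mk0 (φ y) (hpos y hy).ne') : ℝ →L[ℝ] ℝ)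
        (Ici 0) (g (f y)) := by
      rw [hgf y hy]
      exact hdy.hasFDerivWithinAt.congr_fderiv (by ext; simp)
    refine (hdy'.of_local_left_inverse hgc' hfy
      (hsurj.mono fun w hw => hw.2)).hasDerivWithinAt.congr_deriv ?_
    simp
  exact key.derivWithin (uniqueDiffOn_Ici 0 _ hfy)

theorem one_sub_rpow_pos {q t : ℝ} (hq : 0 < q) (ht : t ∈ Ico (0:ℝ) 1) : 0 < 1 - t ^ q :=
  sub_pos.2 (Real.rpow_lt_one ht.1 ht.2 hq)

theorem one_add_rpow_pos {q t : ℝ} (ht : 0 ≤ t) : 0 < 1 + t ^ q :=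
  add_pos_of_pos_of_nonneg one_pos (Real.rpow_nonneg ht q)

theorem continuousOn_one_sub_rpow_rpow (p : ℝ) {q : ℝ} (hq : 0 < q) :
    ContinuousOn (fun t : ℝ => (1 - t ^ q) ^ p) (Ico 0 1) :=
  (continuousOn_const.sub (Real.continuous_rpow_const hq.le).continuousOn).rpow_const
    fun _ ht => Or.inl (one_sub_rpow_pos hq ht).ne'

theorem continuousOn_one_add_rpow_rpow (p : ℝ) {q : ℝ} (hq : 0 < q) :
    ContinuousOn (fun t : ℝ => (1 + t ^ q) ^ p) (Ici 0) :=
  (continuousOn_const.add (Real.continuous_rpow_const hq.le).continuousOn).rpow_const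
    fun _ ht => Or.inl (one_add_rpow_pos ht).ne'

theorem gcos_genF {p q y : ℝ} (hq : 0 < q) (hy : y ∈ Ico (0:ℝ) 1) :
    gcos p q (genF p q y) = (1 - y ^ q) ^ (1 / p) := by
  have h := derivWithin_invFunOn_integral (s := Ico 0 1)
    (fun y hy => ⟨hy.1, fun t ht => ⟨ht.1, ht.2.trans_lt hy.2⟩⟩)
    (fun y hy => ⟨(y + 1) / 2, ⟨by linarith [hy.1], by linarith [hy.2]⟩, by linarith [hy.2]⟩)
    (continuousOn_one_sub_rpow_rpow (-(1 / p)) hq)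
    (fun t ht => Real.rpow_pos_of_pos (one_sub_rpow_pos hq ht) _) hy
  rw [← Real.rpow_neg (one_sub_rpow_pos hq hy).le, neg_neg] at h
  exact h

theorem gcosh_genG {p q z : ℝ} (hq : 0 < q) (hz : 0 ≤ z) :
    gcosh p q (genG p q z) = (1 + z ^ q) ^ (1 / p) := by
  have h := derivWithin_invFunOn_integral (s := Ici 0)
    (fun y hy => ⟨hy, Icc_subset_Ici_self⟩)
    (fun y hy => ⟨y + 1, mem_Ici.2 (add_nonneg hy zero_le_one), by linarith⟩)
    (continuousOn_one_add_rpow_rpow (-(1 / p)) hq)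
    (fun t ht => Real.rpow_pos_of_pos (one_add_rpow_pos ht) _) hz
  rw [← Real.rpow_neg (one_add_rpow_pos hz).le, neg_neg] at h
  exact h

/-- `genF p q` maps `[0, 1)` onto `[0, π_{p,q}/2)`. -/
theorem exists_genF_eq {p q x : ℝ} (hq : 0 < q) (hx0 : 0 ≤ x)
    (hx : ENNReal.ofReal x < genPi p q / 2) : ∃ y ∈ Ico (0:ℝ) 1, genF p q y = x := by
  have hφ := continuousOn_one_sub_rpow_rpow (-(1 / p)) hq
  have hφi : ∀ y ∈ Ico (0:ℝ) 1, ContinuousOn (fun t : ℝ => (1 - t ^ q) ^ (-(1 / p))) (Icc 0 y) :=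
    fun y hy => hφ.mono fun t ht => ⟨ht.1, ht.2.trans_lt hy.2⟩
  obtain ⟨b, hb, hxb⟩ : ∃ b ∈ Ico (0:ℝ) 1, x ≤ genF p q b := by
    by_contra! hcon
    refine hx.not_ge ?_
    have hU : Ioo (0:ℝ) 1 = ⋃ n : ℕ, Ioc 0 (1 - 1 / ((n:ℝ) + 1)) := by
      ext t
      simp only [mem_Ioo, mem_iUnion, mem_Ioc]
      refine ⟨fun h => ?_, fun ⟨n, h1, h2⟩ => ⟨h1, h2.trans_lt ?_⟩⟩
      · obtain ⟨n, hn⟩ := exists_nat_one_div_lt (sub_pos.2 h.2)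
        exact ⟨n, h.1, by linarith⟩
      · have : 0 < 1 / ((n:ℝ) + 1) := by positivity
        linarith
    have hdir : Monotone fun n : ℕ => Ioc (0:ℝ) (1 - 1 / ((n:ℝ) + 1)) := fun m n hmn =>
      Ioc_subset_Ioc_right (sub_le_sub_left (Nat.one_div_le_one_div hmn) 1)
    rw [genPi, mul_comm, ENNReal.mul_div_cancel_right two_ne_zero ENNReal.ofNat_ne_top, hU,
      setLIntegral_iUnion_of_directed _ hdir.directed_le]
    refine iSup_le fun n => ?_
    set y : ℝ := 1 - 1 / ((n:ℝ) + 1)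
    have hy01 : y ∈ Ico (0:ℝ) 1 := by
      have h1 : 0 < 1 / ((n:ℝ) + 1) := by positivity
      have h2 : 1 / ((n:ℝ) + 1) ≤ 1 := by
        rw [div_le_one (by positivity)]
        linarith [n.cast_nonneg (α := ℝ)]
      exact ⟨by linarith, by linarith⟩
    rw [← ofReal_integral_eq_lintegral_ofReal
      ((hφi y hy01).integrableOn_Icc.mono_set Ioc_subset_Icc_self)
      (ae_restrict_of_forall_mem measurableSet_Ioc fun t ht =>
        Real.rpow_nonneg (one_sub_rpow_pos hq ⟨ht.1.le, ht.2.trans_lt hy01.2⟩).le _),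
      ← intervalIntegral.integral_of_le hy01.1]
    exact ENNReal.ofReal_le_ofReal (hcon y hy01).le
  have hc : ContinuousOn (genF p q) (Icc 0 b) := fun u hu =>
    (hasDerivWithinAt_integral_Ici (b := (b + 1) / 2)
      (hφi _ ⟨by linarith [hb.1], by linarith [hb.2]⟩) hu.1
      (by linarith [hu.2, hb.2])).continuousWithinAt.mono Icc_subset_Ici_self
  obtain ⟨y, hy, hyx⟩ := intermediate_value_Icc hb.1 hc (show x ∈ _ from ⟨by simpa [genF], hxb⟩)
  exact ⟨y, ⟨hy.1, hy.2.trans_lt hb.2⟩, hyx⟩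

theorem mul_one_sub_rpow_rpow {q t : ℝ} (hq : 0 < q) (ht : t ∈ Ico (0:ℝ) 1) :
    1 + (t * (1 - t ^ q) ^ (-(1 / q))) ^ q = (1 - t ^ q)⁻¹ := by
  have h := one_sub_rpow_pos hq ht
  rw [Real.mul_rpow ht.1 (Real.rpow_nonneg h.le _), ← Real.rpow_mul h.le,
    show -(1 / q) * q = -1 by field_simp, Real.rpow_neg_one]
  field_simp
  ring

theorem hasDerivAt_mul_one_sub_rpow {q t : ℝ} (hq : 1 ≤ q) (ht : t ∈ Ico (0:ℝ) 1) :
    HasDerivAt (fun t : ℝ => t * (1 - t ^ q) ^ (-(1 / q))) ((1 - t ^ q) ^ (-(1 / q) - 1)) t := by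
  have hq0 : 0 < q := one_pos.trans_le hq
  have h := one_sub_rpow_pos hq0 ht
  have h1 : HasDerivAt (fun t : ℝ => 1 - t ^ q) (-(q * t ^ (q - 1))) t :=
    (Real.hasDerivAt_rpow_const (Or.inr hq)).const_sub 1
  refine ((hasDerivAt_id t).mul (h1.rpow_const (Or.inl h.ne'))).congr_deriv ?_
  have h2 : t * t ^ (q - 1) = t ^ q := by
    rcases ht.1.eq_or_lt with rfl | h0
    · simp [Real.zero_rpow hq0.ne']
    · rw [Real.rpow_sub_one h0.ne']
      field_simp
  have h3 : (1 - t ^ q) ^ (-(1 / q)) = (1 - t ^ q) ^ (-(1 / q) - 1) * (1 - t ^ q) := by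
    rw [Real.rpow_sub_one h.ne']
    field_simp
  simp only [id]
  rw [h3]
  have h4 : q * q⁻¹ = 1 := mul_inv_cancel₀ hq0.ne'
  linear_combination (1 - t ^ q) ^ (-(1 / q) - 1) * h2
    + (1 - t ^ q) ^ (-(1 / q) - 1) * t * t ^ (q - 1) * h4

theorem genG_mul_one_sub_rpow {p q r y : ℝ} (hq : 1 ≤ q) (hr : 1 / r = 1 + 1 / q - 1 / p)
    (hy : y ∈ Ico (0:ℝ) 1) : genG r q (y * (1 - y ^ q) ^ (-(1 / q))) = genF p q y := by
  have hq0 : 0 < q := one_pos.trans_le hq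
  have hsub : uIcc 0 y ⊆ Ico 0 1 := by
    rw [uIcc_of_le hy.1]
    exact fun t ht => ⟨ht.1, ht.2.trans_lt hy.2⟩
  have h := intervalIntegral.integral_comp_mul_deriv' (a := 0) (b := y)
    (g := fun t : ℝ => (1 + t ^ q) ^ (-(1 / r)))
    (fun t ht => hasDerivAt_mul_one_sub_rpow hq (hsub ht))
    ((continuousOn_one_sub_rpow_rpow _ hq0).mono hsub)
    ((continuousOn_one_add_rpow_rpow _ hq0).mono (by
      rintro _ ⟨t, ht, rfl⟩
      exact mul_nonneg (hsub ht).1 (Real.rpow_nonneg (one_sub_rpow_pos hq0 (hsub ht)).le _)))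
  rw [zero_mul] at h
  rw [genG, genF, ← h]
  refine intervalIntegral.integral_congr fun t ht => ?_
  have hp := one_sub_rpow_pos hq0 (hsub ht)
  simp only [Function.comp_apply]
  rw [mul_one_sub_rpow_rpow hq0 (hsub ht), Real.inv_rpow hp.le, ← Real.rpow_neg hp.le, neg_neg,
    ← Real.rpow_add hp, hr]
  congr 1
  ring

/-- for `q/(q+1) < p < ∞`, `1 < q < ∞`, `r = pq/(pq+p-q)` and
`x ∈ [0, π_{p,q}/2)`, `cos_{p,q} x = 1 / (cosh_{r,q} x)^(r/p)`. -/
theorem cos_eq_one_div_cosh_rpow (p q r : ℝ) (hq : 1 < q) (hp : q / (q + 1) < p)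
    (hr : r = p * q / (p * q + p - q)) (x : ℝ) (hx0 : 0 ≤ x)
    (hx : ENNReal.ofReal x < genPi p q / 2) :
    gcos p q x = 1 / gcosh r q x ^ (r / p) := by
  have hq0 : 0 < q := one_pos.trans hq
  have hp0 : 0 < p := lt_trans (by positivity) hp
  have hd : 0 < p * q + p - q := by
    rw [div_lt_iff₀ (by positivity)] at hp
    linarith
  have hr0 : 0 < r := by
    rw [hr]
    positivity
  have hr' : 1 / r = 1 + 1 / q - 1 / p := by
    rw [hr]
    field_simp
  obtain ⟨y, hy, rfl⟩ := exists_genF_eq hq0 hx0 hx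
  have h := one_sub_rpow_pos hq0 hy
  rw [gcos_genF hq0 hy, ← genG_mul_one_sub_rpow hq.le hr' hy,
    gcosh_genG hq0 (mul_nonneg hy.1 (Real.rpow_nonneg h.le _)), mul_one_sub_rpow_rpow hq0 hy,
    ← Real.rpow_mul (inv_pos.2 h).le, show 1 / r * (r / p) = 1 / p by field_simp,
    Real.inv_rpow h.le, one_div (_ ⁻¹), inv_inv]
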